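/- Let λ be the number of black points contained in any secant plane. Then the total number of black points of PG(3,q) equals λ(q+1); in particular, the total number of black points is at most (q+1)^2. -/

import Mathlib

open Submodule Set

/-- The points of `PG(3,q)`: the 1-dimensional subspaces of a 4-dimensional
vector space over the field `K` of order `q`. -/
def pgPoint (K : Type) [Field K] : Set (Submodule K (Fin 4 → K)) :=
  {W | Module.finrank K ↥W = 1}

/-- The lines of `PG(3,q)`: the 2-dimensional subspaces. -/
def pgLine (K : Type) [Field K] : Set (Submodule K (Fin 4 → K)) :=
  {W | Module.finrank K ↥W = 2}

/-- The planes of `PG(3,q)`: the 3-dimensional subspaces. -/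
def pgPlane (K : Type) [Field K] : Set (Submodule K (Fin 4 → K)) :=
  {W | Module.finrank K ↥W = 3}

/-- The lines of the family `S` passing through the point `p`. -/
def linesThru (K : Type) [Field K] (S : Set (Submodule K (Fin 4 → K)))
    (p : Submodule K (Fin 4 → K)) : Set (Submodule K (Fin 4 → K)) :=
  {l | l ∈ S ∧ p ≤ l}

/-- The lines of the family `S` contained in the plane `π` (the set `S_π`). -/
def linesIn (K : Type) [Field K] (S : Set (Submodule K (Fin 4 → K)))
    (π : Submodule K (Fin 4 → K)) : Set (Submodule K (Fin 4 → K)) :=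
  {l | l ∈ S ∧ l ≤ π}

/-- The lines of `S_π` belonging to the pencil of lines of the plane `π`
through the point `p`. -/
def pencilS (K : Type) [Field K] (S : Set (Submodule K (Fin 4 → K)))
    (p π : Submodule K (Fin 4 → K)) : Set (Submodule K (Fin 4 → K)) :=
  {l | l ∈ S ∧ p ≤ l ∧ l ≤ π}

/-- Property (P1): every point lies on exactly `q(q+1)/2` or exactly `q^2`
lines of `S`, and both numbers are attained. -/
def P1 (K : Type) [Field K] (S : Set (Submodule K (Fin 4 → K))) (q : ℕ) : Prop :=
  (∀ p ∈ pgPoint K, (linesThru K S p).ncard = q * (q + 1) / 2 ∨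
      (linesThru K S p).ncard = q ^ 2) ∧
  (∃ p ∈ pgPoint K, (linesThru K S p).ncard = q * (q + 1) / 2) ∧
  (∃ p ∈ pgPoint K, (linesThru K S p).ncard = q ^ 2)

/-- Property (P2): every plane contains exactly `q(q+1)/2` or exactly `q^2`
lines of `S`. -/
def P2 (K : Type) [Field K] (S : Set (Submodule K (Fin 4 → K))) (q : ℕ) : Prop :=
  ∀ π ∈ pgPlane K, (linesIn K S π).ncard = q * (q + 1) / 2 ∨
    (linesIn K S π).ncard = q ^ 2

/-- Property (P2a): if a plane contains `q^2` lines of `S`, then every pencil of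
lines in that plane contains `0` or `q` lines of `S`. -/
def P2a (K : Type) [Field K] (S : Set (Submodule K (Fin 4 → K))) (q : ℕ) : Prop :=
  ∀ π ∈ pgPlane K, (linesIn K S π).ncard = q ^ 2 →
    ∀ p ∈ pgPoint K, p ≤ π →
      (pencilS K S p π).ncard = 0 ∨ (pencilS K S p π).ncard = q

/-- Property (P2b): if a plane contains `q(q+1)/2` lines of `S`, then every
pencil of lines in that plane contains `(q-1)/2`, `(q+1)/2` or `q` lines of `S`. -/
def P2b (K : Type) [Field K] (S : Set (Submodule K (Fin 4 → K))) (q : ℕ) : Prop :=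
  ∀ π ∈ pgPlane K, (linesIn K S π).ncard = q * (q + 1) / 2 →
    ∀ p ∈ pgPoint K, p ≤ π →
      (pencilS K S p π).ncard = (q - 1) / 2 ∨
      (pencilS K S p π).ncard = (q + 1) / 2 ∨
      (pencilS K S p π).ncard = q

/-- A point is black if it lies on exactly `q^2` lines of `S`. -/
def IsBlack (K : Type) [Field K] (S : Set (Submodule K (Fin 4 → K))) (q : ℕ)
    (p : Submodule K (Fin 4 → K)) : Prop :=
  p ∈ pgPoint K ∧ (linesThru K S p).ncard = q ^ 2

/-- A plane is tangent if it contains exactly `q^2` lines of `S`. -/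
def IsTangent (K : Type) [Field K] (S : Set (Submodule K (Fin 4 → K))) (q : ℕ)
    (π : Submodule K (Fin 4 → K)) : Prop :=
  π ∈ pgPlane K ∧ (linesIn K S π).ncard = q ^ 2

/-- A plane is secant if it contains exactly `q(q+1)/2` lines of `S`. -/
def IsSecant (K : Type) [Field K] (S : Set (Submodule K (Fin 4 → K))) (q : ℕ)
    (π : Submodule K (Fin 4 → K)) : Prop :=
  π ∈ pgPlane K ∧ (linesIn K S π).ncard = q * (q + 1) / 2

/-- For a secant plane `π`, the set `α(π)` of points of `π` lying on exactly
`(q-1)/2` lines of `S_π`. -/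
def alphaSet (K : Type) [Field K] (S : Set (Submodule K (Fin 4 → K))) (q : ℕ)
    (π : Submodule K (Fin 4 → K)) : Set (Submodule K (Fin 4 → K)) :=
  {p | p ∈ pgPoint K ∧ p ≤ π ∧ (pencilS K S p π).ncard = (q - 1) / 2}

/-- For a secant plane `π`, the set `β(π)` of points of `π` lying on exactly
`(q+1)/2` lines of `S_π`. -/
def betaSet (K : Type) [Field K] (S : Set (Submodule K (Fin 4 → K))) (q : ℕ)
    (π : Submodule K (Fin 4 → K)) : Set (Submodule K (Fin 4 → K)) :=
  {p | p ∈ pgPoint K ∧ p ≤ π ∧ (pencilS K S p π).ncard = (q + 1) / 2}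

/-- For a secant plane `π`, the set `γ(π)` of points of `π` lying on exactly
`q` lines of `S_π`. -/
def gammaSet (K : Type) [Field K] (S : Set (Submodule K (Fin 4 → K))) (q : ℕ)
    (π : Submodule K (Fin 4 → K)) : Set (Submodule K (Fin 4 → K)) :=
  {p | p ∈ pgPoint K ∧ p ≤ π ∧ (pencilS K S p π).ncard = q}

section SubspaceCounting

open Module Classical

variable {K V : Type*} [Field K] [AddCommGroup V] [Module K V] [Finite V]

/-- The subspaces of dimension `n` lying between `A` and `B`. -/
noncomputable def subspacesBetween (n : ℕ) (A B : Submodule K V) : Finset (Submodule K V) :=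
  (Set.toFinite {W : Submodule K V | finrank K W = n ∧ A ≤ W ∧ W ≤ B}).toFinset

lemma mem_subspacesBetween {n : ℕ} {A B W : Submodule K V} :
    W ∈ subspacesBetween n A B ↔ finrank K W = n ∧ A ≤ W ∧ W ≤ B := by
  simp [subspacesBetween]

lemma sup_eq_and_finrank_inf_of_covered {U W B : Submodule K V} {n : ℕ}
    (hU : finrank K U = n + 1) (hW : finrank K W = n + 1) (hB : finrank K B = n + 2)
    (hUB : U ≤ B) (hWB : W ≤ B) (hne : U ≠ W) : U ⊔ W = B ∧ finrank K ↥(U ⊓ W) = n := by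
  have hlt : U < U ⊔ W := by
    refine lt_of_le_of_ne le_sup_left fun h => hne ?_
    exact (eq_of_le_of_finrank_eq (sup_eq_left.mp h.symm) (hW.trans hU.symm)).symm
  have h1 := finrank_lt_finrank_of_lt hlt
  have h2 := finrank_mono (sup_le hUB hWB)
  have h3 := finrank_sup_add_finrank_inf_eq U W
  exact ⟨eq_of_le_of_finrank_eq (sup_le hUB hWB) (by omega), by omega⟩

lemma inf_eq_and_finrank_sup_of_covering {U W A : Submodule K V} {n : ℕ}
    (hU : finrank K U = n + 1) (hW : finrank K W = n + 1) (hA : finrank K A = n)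
    (hAU : A ≤ U) (hAW : A ≤ W) (hne : U ≠ W) : U ⊓ W = A ∧ finrank K ↥(U ⊔ W) = n + 2 := by
  have hlt : U ⊓ W < U := by
    refine lt_of_le_of_ne inf_le_left fun h => hne ?_
    exact eq_of_le_of_finrank_eq (inf_eq_left.mp h) (hU.trans hW.symm)
  have h1 := finrank_lt_finrank_of_lt hlt
  have h2 := finrank_mono (le_inf hAU hAW)
  have h3 := finrank_sup_add_finrank_inf_eq U W
  exact ⟨(eq_of_le_of_finrank_eq (le_inf hAU hAW) (by omega)).symm, by omega⟩

lemma finrank_sup_span_singleton_of_notMem {A : Submodule K V} {v : V} (hv : v ∉ A) :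
    finrank K ↥(A ⊔ span K {v}) = finrank K A + 1 := by
  have hv0 : v ≠ 0 := fun h => hv (h ▸ A.zero_mem)
  have h3 := finrank_sup_add_finrank_inf_eq A (span K {v})
  have h4 := finrank_span_singleton (K := K) hv0
  have h5 : A ⊓ span K {v} = ⊥ :=
    disjoint_iff.mp ((disjoint_span_singleton' hv0).mpr hv)
  rw [h5, finrank_bot] at h3
  omega

/-- An interval of length two in the subspace lattice has `q + 1` inner elements. -/
lemma card_subspacesBetween [Fintype K] {n : ℕ} {A B : Submodule K V} (hA : finrank K A = n)
    (hB : finrank K B = n + 2) (hAB : A ≤ B) :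
    (subspacesBetween (n + 1) A B).card = Fintype.card K + 1 := by
  let vec : Submodule K V → Finset V := fun W => (Set.toFinite (W : Set V)).toFinset
  have hmem : ∀ W v, v ∈ vec W ↔ v ∈ W := by simp [vec]
  have hcard : ∀ W, (vec W).card = Fintype.card K ^ finrank K W := fun W => by
    rw [← Nat.card_eq_fintype_card, ← Module.natCard_eq_pow_finrank (K := K) (V := W),
      ← Set.ncard_eq_toFinset_card]
    rfl
  have hsdiff : ∀ W, A ≤ W → (vec W \ vec A).card =
      Fintype.card K ^ finrank K W - Fintype.card K ^ n := fun W hW => by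
    rw [Finset.card_sdiff_of_subset (fun v hv => (hmem _ _).2 (hW ((hmem _ _).1 hv))), hcard,
      hcard, hA]
  have hmaps : ∀ v ∈ vec B \ vec A, A ⊔ span K {v} ∈ subspacesBetween (n + 1) A B := by
    intro v hv
    rw [Finset.mem_sdiff, hmem, hmem] at hv
    refine mem_subspacesBetween.2 ⟨?_, le_sup_left, sup_le hAB ?_⟩
    · rw [finrank_sup_span_singleton_of_notMem hv.2, hA]
    · simpa [span_le] using hv.1
  have hfiber : ∀ W ∈ subspacesBetween (n + 1) A B,
      ((vec B \ vec A).filter fun v => A ⊔ span K {v} = W) = vec W \ vec A := by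
    intro W hW
    obtain ⟨hWn, hAW, hWB⟩ := mem_subspacesBetween.1 hW
    ext v
    simp only [Finset.mem_filter, Finset.mem_sdiff, hmem]
    constructor
    · rintro ⟨⟨-, hvA⟩, rfl⟩
      exact ⟨mem_sup_right (mem_span_singleton_self v), hvA⟩
    · rintro ⟨hvW, hvA⟩
      refine ⟨⟨hWB hvW, hvA⟩, eq_of_le_of_finrank_eq (sup_le hAW ?_) ?_⟩
      · simpa [span_le] using hvW
      · rw [finrank_sup_span_singleton_of_notMem hvA, hA, hWn]
  have hcount := Finset.card_eq_sum_card_fiberwise hmaps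
  rw [Finset.sum_congr rfl fun W hW => by
      rw [hfiber W hW, hsdiff W (mem_subspacesBetween.1 hW).2.1, (mem_subspacesBetween.1 hW).1],
    hsdiff B hAB, hB, Finset.sum_const, smul_eq_mul] at hcount
  have hq : 1 < Fintype.card K := Fintype.one_lt_card
  generalize Fintype.card K = q at *
  obtain ⟨r, rfl⟩ : ∃ r, q = r + 1 := ⟨q - 1, by omega⟩
  have hpos : 0 < (r + 1) ^ n * r := by
    have : 0 < r := by omega
    positivity
  have e1 : (r + 1) ^ (n + 2) - (r + 1) ^ n = (r + 1 + 1) * ((r + 1) ^ n * r) :=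
    Nat.sub_eq_of_eq_add (by ring)
  have e2 : (r + 1) ^ (n + 1) - (r + 1) ^ n = (r + 1) ^ n * r :=
    Nat.sub_eq_of_eq_add (by ring)
  rw [e1, e2] at hcount
  exact (Nat.eq_of_mul_eq_mul_right hpos hcount).symm

/-- Weighted double counting of an incidence relation. -/
lemma sum_card_filter_mul_eq {α β : Type*} (s : Finset α) (t : Finset β) (r : α → β → Prop)
    (f : α → ℤ) :
    ∑ a ∈ s, ((t.filter (r a)).card : ℤ) * f a =
      ∑ b ∈ t, ∑ a ∈ s.filter (fun a => r a b), f a := by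
  simp_rw [Finset.card_filter, Nat.cast_sum, Finset.sum_mul, Finset.sum_filter]
  rw [Finset.sum_comm]
  refine Finset.sum_congr rfl fun b _ => Finset.sum_congr rfl fun a _ => ?_
  split_ifs <;> simp

lemma sum_card_filter_comm {α β : Type*} (s : Finset α) (t : Finset β) (r : α → β → Prop) :
    ∑ a ∈ s, (t.filter (r a)).card = ∑ b ∈ t, (s.filter (fun a => r a b)).card :=
  Finset.sum_card_bipartiteAbove_eq_sum_card_bipartiteBelow r

lemma sum_one_add_ite {α : Type*} [DecidableEq α] (X : Finset α) (y : α) (q : ℕ) :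
    ∑ m ∈ X, (1 + if m = y then q else 0) = X.card + if y ∈ X then q else 0 := by
  rw [Finset.sum_add_distrib, Finset.sum_ite_eq']
  simp

/-- Among the covers of `Y` inside `C`, each subspace `m ≠ Y` of `X` lies in exactly one. -/
lemma sum_card_filter_le_of_covers [Fintype K] {n : ℕ} {A C Y : Submodule K V}
    (hA : finrank K A = n) (hC : finrank K C = n + 3) (hY : finrank K Y = n + 1)
    (hAY : A ≤ Y) (hYC : Y ≤ C) (X : Finset (Submodule K V))
    (hX : ∀ m ∈ X, finrank K m = n + 1 ∧ A ≤ m ∧ m ≤ C) :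
    ∑ Z ∈ subspacesBetween (n + 2) Y C, (X.filter (· ≤ Z)).card =
      X.card + if Y ∈ X then Fintype.card K else 0 := by
  rw [sum_card_filter_comm _ _ (fun Z m => m ≤ Z), ← sum_one_add_ite]
  refine Finset.sum_congr rfl fun m hm => ?_
  obtain ⟨hmn, hAm, hmC⟩ := hX m hm
  split_ifs with h
  · subst h
    rw [Finset.filter_true_of_mem fun Z hZ => (mem_subspacesBetween.1 hZ).2.1,
      card_subspacesBetween hY hC hYC, add_comm]
  · obtain ⟨-, hsup⟩ := inf_eq_and_finrank_sup_of_covering hmn hY hA hAm hAY h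
    refine Finset.card_eq_one.2 ⟨m ⊔ Y, ?_⟩
    ext Z
    simp only [Finset.mem_filter, mem_subspacesBetween, Finset.mem_singleton]
    constructor
    · rintro ⟨⟨hZ, hYZ, -⟩, hmZ⟩
      exact (eq_of_le_of_finrank_eq (sup_le hmZ hYZ) (hsup.trans hZ.symm)).symm
    · rintro rfl
      exact ⟨⟨hsup, le_sup_right, sup_le hmC hYC⟩, le_sup_left⟩

/-- Among the hyperplanes of `Y`, each subspace `m ≠ Y` of `X` contains exactly one, when all
subspaces considered are hyperplanes of `C`. -/
lemma sum_card_filter_ge_of_covered [Fintype K] {n : ℕ} {A C Y : Submodule K V}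
    (hA : finrank K A = n) (hC : finrank K C = n + 3) (hY : finrank K Y = n + 2)
    (hAY : A ≤ Y) (hYC : Y ≤ C) (X : Finset (Submodule K V))
    (hX : ∀ m ∈ X, finrank K m = n + 2 ∧ A ≤ m ∧ m ≤ C) :
    ∑ Z ∈ subspacesBetween (n + 1) A Y, (X.filter (Z ≤ ·)).card =
      X.card + if Y ∈ X then Fintype.card K else 0 := by
  rw [sum_card_filter_comm _ _ (fun Z m => Z ≤ m), ← sum_one_add_ite]
  refine Finset.sum_congr rfl fun m hm => ?_
  obtain ⟨hmn, hAm, hmC⟩ := hX m hm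
  split_ifs with h
  · subst h
    rw [Finset.filter_true_of_mem fun Z hZ => (mem_subspacesBetween.1 hZ).2.2,
      card_subspacesBetween hA hY hAY, add_comm]
  · obtain ⟨-, hinf⟩ := sup_eq_and_finrank_inf_of_covered hmn hY hC hmC hYC h
    refine Finset.card_eq_one.2 ⟨m ⊓ Y, ?_⟩
    ext Z
    simp only [Finset.mem_filter, mem_subspacesBetween, Finset.mem_singleton]
    constructor
    · rintro ⟨⟨hZ, -, hZY⟩, hZm⟩
      exact eq_of_le_of_finrank_eq (le_inf hZm hZY) (hZ.trans hinf.symm)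
    · rintro rfl
      exact ⟨⟨hinf, le_inf hAm hAY, inf_le_right⟩, inf_le_left⟩

/-- The number of lines of a projective plane of order `q`. -/
lemma card_subspacesBetween_two_bot [Fintype K] {C : Submodule K V} (hC : finrank K C = 3) :
    (subspacesBetween 2 ⊥ C).card = Fintype.card K ^ 2 + Fintype.card K + 1 := by
  have hb : finrank K (⊥ : Submodule K V) = 0 := finrank_bot K V
  obtain ⟨v, hv, hv0⟩ : ∃ v ∈ C, v ≠ 0 := by
    apply Submodule.exists_mem_ne_zero_of_ne_bot
    rintro rfl
    omega
  have hp := finrank_span_singleton (K := K) hv0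
  have hpC : span K {v} ≤ C := by simpa [span_le] using hv
  have hpos : 0 < (subspacesBetween 2 (span K {v}) C).card := by
    rw [card_subspacesBetween hp hC hpC]; omega
  obtain ⟨l, hl⟩ := Finset.card_pos.1 hpos
  obtain ⟨hl2, -, hlC⟩ := mem_subspacesBetween.1 hl
  have h := sum_card_filter_ge_of_covered hb hC hl2 bot_le hlC (subspacesBetween 2 ⊥ C)
    fun m hm => mem_subspacesBetween.1 hm
  rw [if_pos (mem_subspacesBetween.2 ⟨hl2, bot_le, hlC⟩)] at h
  have hx : ∀ p ∈ subspacesBetween 1 ⊥ l,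
      ((subspacesBetween 2 ⊥ C).filter (p ≤ ·)).card = Fintype.card K + 1 := by
    intro p hp
    obtain ⟨hp1, -, hpl⟩ := mem_subspacesBetween.1 hp
    rw [← card_subspacesBetween hp1 hC (hpl.trans hlC)]
    congr 1
    ext m
    simp only [Finset.mem_filter, mem_subspacesBetween, bot_le, true_and]
    tauto
  rw [Finset.sum_congr rfl hx, Finset.sum_const, card_subspacesBetween hb hl2 bot_le,
    smul_eq_mul] at h
  nlinarith

/-- Points off `Y` are partitioned by the covers of `Y`. -/
lemma sum_card_filter_le_of_disjoint {n : ℕ} {Y : Submodule K V} (hY : finrank K Y = n)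
    (X : Finset (Submodule K V)) (hX : ∀ p ∈ X, finrank K p = 1 ∧ ¬ p ≤ Y) :
    ∑ Z ∈ subspacesBetween (n + 1) Y ⊤, (X.filter (· ≤ Z)).card = X.card := by
  rw [sum_card_filter_comm _ _ (fun Z m => m ≤ Z), Finset.card_eq_sum_ones]
  refine Finset.sum_congr rfl fun p hp => ?_
  obtain ⟨hp1, hpY⟩ := hX p hp
  have hsup : finrank K ↥(p ⊔ Y) = n + 1 := by
    have h1 := finrank_sup_add_finrank_inf_eq p Y
    have h2 := finrank_lt_finrank_of_lt
      (lt_of_le_of_ne inf_le_left fun h => hpY (inf_eq_left.mp h) : p ⊓ Y < p)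
    omega
  refine Finset.card_eq_one.2 ⟨p ⊔ Y, ?_⟩
  ext Z
  simp only [Finset.mem_filter, mem_subspacesBetween, Finset.mem_singleton]
  constructor
  · rintro ⟨⟨hZ, hYZ, -⟩, hpZ⟩
    exact (eq_of_le_of_finrank_eq (sup_le hpZ hYZ) (hsup.trans hZ.symm)).symm
  · rintro rfl
    exact ⟨⟨hsup, le_sup_right, le_top⟩, le_sup_left⟩

lemma sum_pencil_over_points [Fintype K] {l π : Submodule K V} (hl : finrank K l = 2)
    (hπ : finrank K π = 3) (hlπ : l ≤ π) (T : Finset (Submodule K V))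
    (hT : ∀ m ∈ T, finrank K m = 2) :
    ∑ p ∈ subspacesBetween 1 ⊥ l, (T.filter fun m => p ≤ m ∧ m ≤ π).card =
      (T.filter (· ≤ π)).card + if l ∈ T then Fintype.card K else 0 := by
  have h := sum_card_filter_ge_of_covered (finrank_bot K V) hπ hl bot_le hlπ (T.filter (· ≤ π))
    fun m hm => ⟨hT m (Finset.mem_filter.1 hm).1, bot_le, (Finset.mem_filter.1 hm).2⟩
  simpa only [Finset.filter_filter, Finset.mem_filter, hlπ, true_and, and_true, and_comm] using h

lemma sum_pencil_over_planes [Fintype K] (hV : finrank K V = 4) {p l : Submodule K V}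
    (hp : finrank K p = 1) (hl : finrank K l = 2) (hpl : p ≤ l) (T : Finset (Submodule K V))
    (hT : ∀ m ∈ T, finrank K m = 2) :
    ∑ π ∈ subspacesBetween 3 l ⊤, (T.filter fun m => p ≤ m ∧ m ≤ π).card =
      (T.filter (p ≤ ·)).card + if l ∈ T then Fintype.card K else 0 := by
  have h := sum_card_filter_le_of_covers hp (C := ⊤) (by rw [finrank_top, hV]) hl hpl le_top
    (T.filter (p ≤ ·))
    fun m hm => ⟨hT m (Finset.mem_filter.1 hm).1, (Finset.mem_filter.1 hm).2, le_top⟩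
  simpa only [Finset.filter_filter, Finset.mem_filter, hpl, and_true] using h

/-- For a family `T` of lines and any line `l`, the degrees of the points on `l` and the degrees
of the planes through `l` have the same sum. -/
lemma sum_point_degrees_eq_sum_plane_degrees [Fintype K] (hV : finrank K V = 4)
    {l : Submodule K V} (hl : finrank K l = 2) (T : Finset (Submodule K V))
    (hT : ∀ m ∈ T, finrank K m = 2) :
    ∑ p ∈ subspacesBetween 1 ⊥ l, (T.filter (p ≤ ·)).card =
      ∑ π ∈ subspacesBetween 3 l ⊤, (T.filter (· ≤ π)).card := by
  have h1 : ∑ p ∈ subspacesBetween 1 ⊥ l, ∑ π ∈ subspacesBetween 3 l ⊤,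
      (T.filter fun m => p ≤ m ∧ m ≤ π).card = _ := Finset.sum_congr rfl fun p hp =>
    sum_pencil_over_planes hV (mem_subspacesBetween.1 hp).1 hl (mem_subspacesBetween.1 hp).2.2 T hT
  have h2 : ∑ π ∈ subspacesBetween 3 l ⊤, ∑ p ∈ subspacesBetween 1 ⊥ l,
      (T.filter fun m => p ≤ m ∧ m ≤ π).card = _ := Finset.sum_congr rfl fun π hπ =>
    sum_pencil_over_points hl (mem_subspacesBetween.1 hπ).1 (mem_subspacesBetween.1 hπ).2.1 T hT
  rw [Finset.sum_comm, h2, Finset.sum_add_distrib, Finset.sum_add_distrib, Finset.sum_const,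
    Finset.sum_const, card_subspacesBetween (finrank_bot K V) hl bot_le,
    card_subspacesBetween hl (by rw [finrank_top, hV]) le_top] at h1
  omega

/-- If a point lies on exactly `q ^ 2` lines of `T` and no pencil at it has more than `q` lines of
`T`, then every such pencil has `0` or `q` lines of `T`. -/
lemma pencil_eq_zero_or_card_of_degree_sq [Fintype K] (hV : finrank K V = 4)
    {p : Submodule K V} (hp : finrank K p = 1) (T : Finset (Submodule K V))
    (hT : ∀ m ∈ T, finrank K m = 2) (hdeg : (T.filter (p ≤ ·)).card = Fintype.card K ^ 2)
    (hle : ∀ π ∈ subspacesBetween 3 p ⊤,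
      (T.filter fun m => p ≤ m ∧ m ≤ π).card ≤ Fintype.card K)
    {π : Submodule K V} (hπ : π ∈ subspacesBetween 3 p ⊤) :
    (T.filter fun m => p ≤ m ∧ m ≤ π).card = 0 ∨
      (T.filter fun m => p ≤ m ∧ m ≤ π).card = Fintype.card K := by
  set x : Submodule K V → ℕ := fun π => (T.filter fun m => p ≤ m ∧ m ≤ π).card
  have hsum := sum_card_filter_mul_eq (subspacesBetween 3 p ⊤) (T.filter (p ≤ ·))
    (fun π m => m ≤ π) (fun π => (Fintype.card K : ℤ) - x π)
  have hinner : ∀ m ∈ T.filter (p ≤ ·),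
      ∑ π ∈ (subspacesBetween 3 p ⊤).filter (fun π => m ≤ π), ((Fintype.card K : ℤ) - x π) = 0 := by
    intro m hm
    obtain ⟨hmT, hpm⟩ := Finset.mem_filter.1 hm
    have hset : (subspacesBetween 3 p ⊤).filter (fun π => m ≤ π) = subspacesBetween 3 m ⊤ := by
      ext π
      simp only [Finset.mem_filter, mem_subspacesBetween, le_top, and_true]
      exact ⟨fun h => ⟨h.1.1, h.2⟩, fun h => ⟨⟨h.1, hpm.trans h.2⟩, h.2⟩⟩
    have hF := sum_pencil_over_planes hV hp (hT m hmT) hpm T hT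
    rw [if_pos hmT, hdeg] at hF
    rw [hset, Finset.sum_sub_distrib, Finset.sum_const,
      card_subspacesBetween (hT m hmT) (by rw [finrank_top, hV]) le_top, ← Nat.cast_sum, hF]
    push_cast
    ring
  rw [Finset.sum_eq_zero hinner] at hsum
  simp only [Finset.filter_filter] at hsum
  have hzero := (Finset.sum_eq_zero_iff_of_nonneg fun π hπ =>
    mul_nonneg (Nat.cast_nonneg _) (sub_nonneg.2 (Nat.cast_le.2 (hle π hπ)))).1 hsum π hπ
  rcases mul_eq_zero.1 hzero with h | h
  · exact Or.inl (by exact_mod_cast h)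
  · exact Or.inr (by exact_mod_cast (sub_eq_zero.1 h).symm)

/-- The first two moments of the intersection numbers of the lines of a plane with a point set. -/
lemma line_intersection_moments [Fintype K] {π : Submodule K V} (hπ : finrank K π = 3)
    (B : Finset (Submodule K V)) (hB : ∀ p ∈ B, finrank K p = 1 ∧ p ≤ π) :
    (∑ l ∈ subspacesBetween 2 ⊥ π, ((B.filter (· ≤ l)).card : ℤ) =
      B.card * (Fintype.card K + 1)) ∧
    ∑ l ∈ subspacesBetween 2 ⊥ π, ((B.filter (· ≤ l)).card : ℤ) * (B.filter (· ≤ l)).card =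
      B.card * (B.card + Fintype.card K) := by
  have hset : ∀ p : Submodule K V, (subspacesBetween 2 ⊥ π).filter (fun l => p ≤ l) =
      subspacesBetween 2 p π := fun p => by
    ext l
    simp only [Finset.mem_filter, mem_subspacesBetween, bot_le, true_and]
    tauto
  constructor
  · have h := sum_card_filter_mul_eq (subspacesBetween 2 ⊥ π) B (fun l p => p ≤ l) (fun _ => 1)
    simp only [mul_one] at h
    rw [h, Finset.sum_congr rfl fun p hp => by
      rw [hset, Finset.sum_const, card_subspacesBetween (hB p hp).1 hπ (hB p hp).2]]
    simp
  · rw [sum_card_filter_mul_eq (subspacesBetween 2 ⊥ π) B (fun l p => p ≤ l)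
      (fun l => ((B.filter (· ≤ l)).card : ℤ)), Finset.sum_congr rfl fun p hp => by
      rw [hset, ← Nat.cast_sum, sum_card_filter_le_of_covers (finrank_bot K V) hπ (hB p hp).1
        bot_le (hB p hp).2 B fun m hm => ⟨(hB m hm).1, bot_le, (hB m hm).2⟩, if_pos hp]]
    simp

/-- An arc of a projective plane has an external line. -/
lemma exists_external_line_of_arc [Fintype K] {π : Submodule K V} (hπ : finrank K π = 3)
    (B : Finset (Submodule K V)) (hB : ∀ p ∈ B, finrank K p = 1 ∧ p ≤ π)
    (harc : ∀ l ∈ subspacesBetween 2 ⊥ π, (B.filter (· ≤ l)).card ≤ 2) :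
    ∃ l ∈ subspacesBetween 2 ⊥ π, (B.filter (· ≤ l)).card = 0 := by
  by_contra! hne
  obtain ⟨hm1, hm2⟩ := line_intersection_moments hπ B hB
  have hq : (2 : ℤ) ≤ Fintype.card K := by exact_mod_cast (Fintype.one_lt_card (α := K))
  have hzero : ∑ l ∈ subspacesBetween 2 ⊥ π, (((B.filter (· ≤ l)).card : ℤ) *
      (B.filter (· ≤ l)).card - 3 * (B.filter (· ≤ l)).card + 2) = 0 :=
    Finset.sum_eq_zero fun l hl => by
      have h1 := harc l hl
      have h2 := hne l hl
      generalize (B.filter (· ≤ l)).card = k at *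
      interval_cases k <;> simp_all
  rw [Finset.sum_add_distrib, Finset.sum_sub_distrib, ← Finset.mul_sum, hm1, hm2,
    Finset.sum_const, card_subspacesBetween_two_bot hπ] at hzero
  push_cast [nsmul_eq_mul] at hzero
  nlinarith [sq_nonneg (2 * (B.card : ℤ) - (2 * Fintype.card K + 3))]

/-- An arc of a projective plane of order `q` has at most `q + 1` points if all its secants
belong to a family of at most `q * (q + 1) / 2` lines. -/
lemma card_arc_le_of_secants_subset [Fintype K] {π : Submodule K V} (hπ : finrank K π = 3)
    (B : Finset (Submodule K V)) (hB : ∀ p ∈ B, finrank K p = 1 ∧ p ≤ π)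
    (harc : ∀ l ∈ subspacesBetween 2 ⊥ π, (B.filter (· ≤ l)).card ≤ 2)
    (T : Finset (Submodule K V)) (hT : ∀ m ∈ T, finrank K m = 2)
    (hsec : ∀ l ∈ subspacesBetween 2 ⊥ π, l ∉ T → (B.filter (· ≤ l)).card ≤ 1)
    (hcard : 2 * (T.filter (· ≤ π)).card ≤ Fintype.card K * (Fintype.card K + 1)) :
    B.card ≤ Fintype.card K + 1 := by
  obtain ⟨hm1, hm2⟩ := line_intersection_moments hπ B hB
  have hle : ∑ l ∈ subspacesBetween 2 ⊥ π, (((B.filter (· ≤ l)).card : ℤ) *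
      (B.filter (· ≤ l)).card - (B.filter (· ≤ l)).card) ≤
      ∑ l ∈ subspacesBetween 2 ⊥ π, if l ∈ T then 2 else 0 :=
    Finset.sum_le_sum fun l hl => by
      have h1 := harc l hl
      have h2 := hsec l hl
      generalize (B.filter (· ≤ l)).card = k at *
      split_ifs with h
      · interval_cases k <;> simp
      · have := h2 h
        interval_cases k <;> simp
  have hset : (subspacesBetween 2 ⊥ π).filter (· ∈ T) = T.filter (· ≤ π) := by
    ext l
    simp only [Finset.mem_filter, mem_subspacesBetween, bot_le, true_and]
    exact ⟨fun h => ⟨h.2, h.1.2⟩, fun h => ⟨⟨hT l h.1, h.2⟩, h.1⟩⟩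
  rw [Finset.sum_sub_distrib, hm1, hm2, ← Finset.sum_filter, hset, Finset.sum_const,
    nsmul_eq_mul] at hle
  have hcard' : (2 : ℤ) * (T.filter (· ≤ π)).card ≤ Fintype.card K * (Fintype.card K + 1) := by
    exact_mod_cast hcard
  by_contra! hlt
  have hlt' : (Fintype.card K : ℤ) + 2 ≤ B.card := by exact_mod_cast hlt
  nlinarith

end SubspaceCounting

/-- If every secant plane contains exactly `lam` black points,
then the total number of black points is `lam * (q+1)`, and in particular it is
at most `(q+1)^2`. -/
theorem stmt_18 (K : Type) [Field K] [Fintype K] (q : ℕ) (hq : Fintype.card K = q)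
    (hq_odd : Odd q) (S : Set (Submodule K (Fin 4 → K))) (hS : S ⊆ pgLine K)
    (h1 : P1 K S q) (h2 : P2 K S q) (h2a : P2a K S q) (h2b : P2b K S q) (lam : ℕ)
    (hlam : ∀ π, IsSecant K S q π → {p | IsBlack K S q p ∧ p ≤ π}.ncard = lam) :
    {p | IsBlack K S q p}.ncard = lam * (q + 1) ∧
    {p | IsBlack K S q p}.ncard ≤ (q + 1) ^ 2 := by
  classical
  have hV : Module.finrank K (Fin 4 → K) = 4 := by simp
  set T : Finset (Submodule K (Fin 4 → K)) := (Set.toFinite S).toFinset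
  have hmemT : ∀ m, m ∈ T ↔ m ∈ S := by simp [T]
  have hT : ∀ m ∈ T, Module.finrank K m = 2 := fun m hm => hS ((hmemT m).1 hm)
  have hthru : ∀ p, (linesThru K S p).ncard = (T.filter (p ≤ ·)).card := fun p => by
    rw [← Set.ncard_coe_finset]
    congr 1
    ext m
    simp [linesThru, hmemT]
  have hin : ∀ π, (linesIn K S π).ncard = (T.filter (· ≤ π)).card := fun π => by
    rw [← Set.ncard_coe_finset]
    congr 1
    ext m
    simp [linesIn, hmemT]
  have hpencil : ∀ p π, (pencilS K S p π).ncard = (T.filter fun m => p ≤ m ∧ m ≤ π).card :=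
    fun p π => by
      rw [← Set.ncard_coe_finset]
      congr 1
      ext m
      simp [pencilS, hmemT]
  set B : Finset (Submodule K (Fin 4 → K)) := (Set.toFinite {p | IsBlack K S q p}).toFinset
  have hmemB : ∀ p, p ∈ B ↔ Module.finrank K p = 1 ∧ (T.filter (p ≤ ·)).card = q ^ 2 :=
    fun p => by simp [B, IsBlack, hthru, pgPoint]
  have hBcard : {p | IsBlack K S q p}.ncard = B.card := Set.ncard_eq_toFinset_card _ _
  have hBplane : ∀ π, {p | IsBlack K S q p ∧ p ≤ π}.ncard = (B.filter (· ≤ π)).card := fun π => by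
    rw [← Set.ncard_coe_finset]
    congr 1
    ext m
    simp [B]
  obtain ⟨r, hr⟩ := hq_odd
  have hq1 : 1 < q := hq ▸ Fintype.one_lt_card
  have hr1 : 1 ≤ r := by omega
  have e1 : q * (q + 1) / 2 = (2 * r + 1) * (r + 1) := by
    rw [hr]; exact Nat.div_eq_of_eq_mul_left two_pos (by ring)
  have e2 : (q - 1) / 2 = r := by omega
  have hlt : q * (q + 1) / 2 < q ^ 2 := by rw [e1, hr]; nlinarith
  simp only [P1, P2, P2a, P2b, IsSecant, hthru, hin, hpencil, hBplane, pgPoint, pgPlane,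
    Set.mem_ofPred_eq] at h1 h2 h2a h2b hlam
  rw [hBcard]
  -- In a secant plane, the pencil at a black point has `q` lines of `S`.
  have hblack : ∀ p ∈ B, ∀ π : Submodule K (Fin 4 → K), Module.finrank K π = 3 → p ≤ π →
      (T.filter (· ≤ π)).card = q * (q + 1) / 2 →
      (T.filter fun m => p ≤ m ∧ m ≤ π).card = q := by
    intro p hp π hπ hpπ hsec
    obtain ⟨hp1, hpdeg⟩ := (hmemB p).1 hp
    have h := pencil_eq_zero_or_card_of_degree_sq hV hp1 T hT (by rw [hpdeg, hq])
      (fun π' hπ' => by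
        obtain ⟨h3, hpπ', -⟩ := mem_subspacesBetween.1 hπ'
        rw [hq]
        rcases h2 π' h3 with h | h
        · rcases h2b π' h3 h p hp1 hpπ' with h | h | h <;> omega
        · rcases h2a π' h3 h p hp1 hpπ' with h | h <;> omega)
      (mem_subspacesBetween.2 ⟨hπ, hpπ, le_top⟩)
    rw [hq] at h
    have := h2b π hπ hsec p hp1 hpπ
    omega
  -- A line has as many black points as tangent planes.
  have hbal : ∀ l : Submodule K (Fin 4 → K), Module.finrank K l = 2 →
      (B.filter (· ≤ l)).card =
      ((subspacesBetween 3 l ⊤).filter fun π => (T.filter (· ≤ π)).card = q ^ 2).card := by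
    intro l hl
    have h := sum_point_degrees_eq_sum_plane_degrees hV hl T hT
    obtain ⟨d, hd⟩ : ∃ d, q ^ 2 = q * (q + 1) / 2 + d := ⟨_, (Nat.add_sub_cancel' hlt.le).symm⟩
    have hd0 : 0 < d := by omega
    have hpt : ∀ p ∈ subspacesBetween 1 ⊥ l, (T.filter (p ≤ ·)).card =
        q * (q + 1) / 2 + if (T.filter (p ≤ ·)).card = q ^ 2 then d else 0 := by
      intro p hp
      rcases h1.1 p (mem_subspacesBetween.1 hp).1 with h | h <;> split_ifs <;> omega
    have hpl : ∀ π ∈ subspacesBetween 3 l ⊤, (T.filter (· ≤ π)).card =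
        q * (q + 1) / 2 + if (T.filter (· ≤ π)).card = q ^ 2 then d else 0 := by
      intro π hπ
      rcases h2 π (mem_subspacesBetween.1 hπ).1 with h | h <;> split_ifs <;> omega
    rw [Finset.sum_congr rfl hpt, Finset.sum_congr rfl hpl, Finset.sum_add_distrib,
      Finset.sum_add_distrib, Finset.sum_const, Finset.sum_const,
      card_subspacesBetween (finrank_bot K _) hl bot_le,
      card_subspacesBetween hl (by rw [finrank_top, hV]) le_top, ← Finset.sum_filter,
      ← Finset.sum_filter, Finset.sum_const, Finset.sum_const, smul_eq_mul, smul_eq_mul] at h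
    have hset : (subspacesBetween 1 ⊥ l).filter (fun p => (T.filter (p ≤ ·)).card = q ^ 2) =
        B.filter (· ≤ l) := by
      ext p
      simp only [Finset.mem_filter, mem_subspacesBetween, bot_le, true_and, hmemB]
      tauto
    rw [hset] at h
    exact Nat.eq_of_mul_eq_mul_right hd0 (Nat.add_left_cancel h)
  obtain ⟨π, hπ, hπsec⟩ : ∃ π : Submodule K (Fin 4 → K),
      Module.finrank K π = 3 ∧ (T.filter (· ≤ π)).card = q * (q + 1) / 2 := by
    by_contra! hno
    obtain ⟨p, hp, hpw⟩ := h1.2.1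
    obtain ⟨l, hl, hpl⟩ : ∃ l : Submodule K (Fin 4 → K), Module.finrank K l = 2 ∧ p ≤ l := by
      have hpt : p < ⊤ := lt_top_iff_ne_top.2 fun h => by
        rw [h, finrank_top, hV] at hp; omega
      obtain ⟨v, -, hv⟩ := SetLike.exists_of_lt hpt
      exact ⟨_, (finrank_sup_span_singleton_of_notMem hv).trans (by rw [hp]), le_sup_left⟩
    have h := hbal l hl
    rw [Finset.filter_true_of_mem fun π hπ =>
      (h2 π (mem_subspacesBetween.1 hπ).1).resolve_left (hno π (mem_subspacesBetween.1 hπ).1),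
      card_subspacesBetween hl (by rw [finrank_top, hV]) le_top,
      ← card_subspacesBetween (finrank_bot K _) hl bot_le] at h
    have hsub : B.filter (· ≤ l) ⊆ subspacesBetween 1 ⊥ l := fun p hp =>
      mem_subspacesBetween.2 ⟨((hmemB p).1 (Finset.mem_filter.1 hp).1).1, bot_le,
        (Finset.mem_filter.1 hp).2⟩
    have hpB : p ∈ B.filter (· ≤ l) := by
      rw [Finset.eq_of_subset_of_card_le hsub h.ge]
      exact mem_subspacesBetween.2 ⟨hp, bot_le, hpl⟩
    have := ((hmemB p).1 (Finset.mem_filter.1 hpB).1).2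
    omega
  have hinter : ∀ l ∈ subspacesBetween 2 ⊥ π, ((B.filter (· ≤ π)).filter (· ≤ l)).card ≤ 2 ∧
      (l ∉ T → ((B.filter (· ≤ π)).filter (· ≤ l)).card ≤ 1) := by
    intro l hl
    obtain ⟨hl2, -, hlπ⟩ := mem_subspacesBetween.1 hl
    have hsum := sum_pencil_over_points hl2 hπ hlπ T hT
    have hset : (subspacesBetween 1 ⊥ l).filter (· ∈ B) =
        (B.filter (· ≤ π)).filter (· ≤ l) := by
      ext p
      simp only [Finset.mem_filter, mem_subspacesBetween, bot_le, true_and, hmemB]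
      exact ⟨fun h => ⟨⟨h.2, h.1.2.trans hlπ⟩, h.1.2⟩, fun h => ⟨⟨h.1.1.1, h.2⟩, h.1.1⟩⟩
    have hlow : ∑ p ∈ subspacesBetween 1 ⊥ l, (r + if p ∈ B then r + 1 else 0) ≤
        ∑ p ∈ subspacesBetween 1 ⊥ l, (T.filter fun m => p ≤ m ∧ m ≤ π).card := by
      refine Finset.sum_le_sum fun p hp => ?_
      obtain ⟨hp1, -, hpl⟩ := mem_subspacesBetween.1 hp
      split_ifs with h
      · rw [hblack p h π hπ (hpl.trans hlπ) hπsec]; omega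
      · have := h2b π hπ hπsec p hp1 (hpl.trans hlπ)
        omega
    rw [hsum, hπsec, Finset.sum_add_distrib, Finset.sum_const, ← Finset.sum_filter,
      Finset.sum_const, hset, card_subspacesBetween (finrank_bot K _) hl2 bot_le, hq, e1,
      smul_eq_mul, smul_eq_mul, hr] at hlow
    generalize ((B.filter (· ≤ π)).filter (· ≤ l)).card = k at *
    constructor
    · by_contra! hk
      split_ifs at hlow <;> nlinarith
    · intro hlT
      rw [if_neg hlT] at hlow
      by_contra! hk
      nlinarith
  have hBπ : ∀ p ∈ B.filter (· ≤ π), Module.finrank K p = 1 ∧ p ≤ π := fun p hp =>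
    ⟨((hmemB p).1 (Finset.mem_filter.1 hp).1).1, (Finset.mem_filter.1 hp).2⟩
  have hlamle : lam ≤ q + 1 := by
    rw [← hlam π ⟨hπ, hπsec⟩, ← hq]
    refine card_arc_le_of_secants_subset hπ _ hBπ (fun l hl => (hinter l hl).1) T hT
      (fun l hl => (hinter l hl).2) ?_
    rw [hπsec, hq]
    exact Nat.mul_div_le _ _
  obtain ⟨l, hl, hl0⟩ := exists_external_line_of_arc hπ _ hBπ fun l hl => (hinter l hl).1
  obtain ⟨hl2, -, hlπ⟩ := mem_subspacesBetween.1 hl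
  have hoff : ∀ p ∈ B, ¬ p ≤ l := fun p hp hpl => by
    have hmem : p ∈ (B.filter (· ≤ π)).filter (· ≤ l) :=
      Finset.mem_filter.2 ⟨Finset.mem_filter.2 ⟨hp, hpl.trans hlπ⟩, hpl⟩
    rw [Finset.card_eq_zero.1 hl0] at hmem
    exact Finset.notMem_empty _ hmem
  have htan := hbal l hl2
  rw [Finset.filter_false_of_mem hoff, Finset.card_empty, eq_comm, Finset.card_eq_zero,
    Finset.filter_eq_empty_iff] at htan
  have htotal : B.card = lam * (q + 1) := by
    rw [← sum_card_filter_le_of_disjoint hl2 B fun p hp => ⟨((hmemB p).1 hp).1, hoff p hp⟩,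
      Finset.sum_congr rfl fun π' hπ' => by
        have h3 := (mem_subspacesBetween.1 hπ').1
        exact hlam π' ⟨h3, (h2 π' h3).resolve_right (htan hπ')⟩,
      Finset.sum_const, card_subspacesBetween hl2 (by rw [finrank_top, hV]) le_top, hq,
      smul_eq_mul, mul_comm]
  refine ⟨htotal, ?_⟩
  rw [htotal]
  nlinarith
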